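/- arXiv:math/0211314 — 2 statements merged into one kernel-verified Lean document; each statement's English description precedes it below -/
import Mathlib

section
/- Let n and r be positive integers with n ≥ 2r, and let 𝒜 ⊆ [n]^(r)_* be an intersecting family of separated r-subsets of [n]. Then |𝒜| ≤ binomial(n−r−1, r−1), which equals the size of the family {A ∈ [n]^(r)_* : 1 ∈ A}. -/
/-- The family of all `k`-separated `r`-subsets of `[n] = {1,…,n}`:
`A = {a₁ < … < a_r} ⊆ [n]` with consecutive circular gaps all `> k`.
Equivalently (for nonempty `A`): `k < n` and every pair `a < b` in `A`
satisfies `b - a > k` and `(a + n) - b > k`. -/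
def sepSets (n k r : ℕ) : Finset (Finset ℕ) :=
  (Finset.Icc 1 n).powerset.filter fun A =>
    A.card = r ∧ k < n ∧ ∀ a ∈ A, ∀ b ∈ A, a < b → k < b - a ∧ b - a + k < n

/-- A family of sets is intersecting if any two members meet. -/
def Intersecting (𝒜 : Finset (Finset ℕ)) : Prop :=
  ∀ A ∈ 𝒜, ∀ B ∈ 𝒜, (A ∩ B).Nonempty

theorem mem_sep {n r : ℕ} {A : Finset ℕ} : A ∈ sepSets n 1 r ↔
    (∀ a ∈ A, 1 ≤ a ∧ a ≤ n) ∧ A.card = r ∧ 1 < n ∧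
      ∀ a ∈ A, ∀ b ∈ A, a < b → 1 < b - a ∧ b - a + 1 < n := by
  simp [sepSets, Finset.subset_iff]

theorem sep_le {n r : ℕ} {A : Finset ℕ} (h : A ∈ sepSets n 1 r) : 2 * r ≤ n := by
  obtain ⟨h1, h2, h3, h4⟩ := mem_sep.1 h
  have hinj : Set.InjOn (fun a => if a = n then 1 else a + 1) (A : Set ℕ) := by
    intro a ha b hb hab
    have := h1 a ha
    have := h1 b hb
    dsimp only at hab
    split_ifs at hab <;> omega
  have hd : Disjoint A (A.image (fun a => if a = n then 1 else a + 1)) := by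
    rw [Finset.disjoint_left]
    intro a ha hb
    obtain ⟨b, hb, hab⟩ := Finset.mem_image.1 hb
    have := h1 a ha
    have := h1 b hb
    split_ifs at hab
    · have := h4 a ha b hb (by omega)
      omega
    · have := h4 b hb a ha (by omega)
      omega
  have hs : A ∪ A.image (fun a => if a = n then 1 else a + 1) ⊆ Finset.Icc 1 n := by
    intro a ha
    rw [Finset.mem_Icc]
    rcases Finset.mem_union.1 ha with ha | ha
    · exact h1 a ha
    · obtain ⟨b, hb, hab⟩ := Finset.mem_image.1 ha
      have := h1 b hb
      split_ifs at hab <;> omega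
  have hc := Finset.card_le_card hs
  rw [Finset.card_union_of_disjoint hd, Finset.card_image_of_injOn hinj] at hc
  simp at hc
  omega

/-- contract the edge 1-2 -/
def ff (A : Finset ℕ) : Finset ℕ := A.image (fun j => max 1 (j - 1))

/-- remove 1, 2 and shift by two -/
def gg (A : Finset ℕ) : Finset ℕ := ((A.erase 1).erase 2).image (fun j => j - 2)

theorem mem_ff {n r : ℕ} {A : Finset ℕ} (h : A ∈ sepSets n 1 r) (x : ℕ) :
    x ∈ ff A ↔ (x = 1 ∧ (1 ∈ A ∨ 2 ∈ A)) ∨ (2 ≤ x ∧ x + 1 ∈ A) := by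
  obtain ⟨h1, h2, h3, h4⟩ := mem_sep.1 h
  simp only [ff, Finset.mem_image]
  constructor
  · rintro ⟨a, ha, rfl⟩
    have := h1 a ha
    rcases (by omega : a = 1 ∨ a = 2 ∨ 3 ≤ a) with rfl | rfl | h
    · simp [ha]
    · simp [ha]
    · right
      have : max 1 (a - 1) + 1 = a := by omega
      rw [this]
      exact ⟨by omega, ha⟩
  · rintro (⟨rfl, h | h⟩ | ⟨hx, h⟩)
    · exact ⟨1, h, by simp⟩
    · exact ⟨2, h, by simp⟩
    · exact ⟨_, h, by omega⟩

theorem mem_gg {n r : ℕ} {A : Finset ℕ} (h : A ∈ sepSets n 1 r) (x : ℕ) :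
    x ∈ gg A ↔ 1 ≤ x ∧ x + 2 ∈ A := by
  obtain ⟨h1, h2, h3, h4⟩ := mem_sep.1 h
  simp only [gg, Finset.mem_image, Finset.mem_erase]
  constructor
  · rintro ⟨a, ⟨h2, h1', ha⟩, rfl⟩
    have := h1 a ha
    have e : a - 2 + 2 = a := by omega
    rw [e]
    exact ⟨by omega, ha⟩
  · rintro ⟨hx, h⟩
    exact ⟨_, ⟨by omega, by omega, h⟩, by omega⟩

theorem ff_sep {n r : ℕ} (hn : 4 ≤ n) {A : Finset ℕ} (h : A ∈ sepSets n 1 r)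
    (h13 : ¬ (1 ∈ A ∧ 3 ∈ A)) (h2n : ¬ (2 ∈ A ∧ n ∈ A)) : ff A ∈ sepSets (n - 1) 1 r := by
  have hf := mem_ff h
  obtain ⟨h1, h2, h3, h4⟩ := mem_sep.1 h
  refine mem_sep.2 ⟨?_, ?_, by omega, ?_⟩
  · intro a ha
    rcases (hf a).1 ha with ⟨rfl, _⟩ | ⟨hx, ha⟩
    · omega
    · have := h1 _ ha
      omega
  · rw [ff, Finset.card_image_of_injOn, h2]
    intro a ha b hb hab
    have := h1 a ha
    have := h1 b hb
    have := h4 a ha b hb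
    have := h4 b hb a ha
    dsimp only at hab
    omega
  · intro a ha b hb hab
    rcases (hf a).1 ha with ⟨rfl, ha | ha⟩ | ⟨hx, ha⟩ <;>
    rcases (hf b).1 hb with ⟨rfl, hb | hb⟩ | ⟨hy, hb⟩ <;> try omega
    · have := h1 _ hb
      have := h4 _ ha _ hb (by omega)
      have : b ≠ 2 := by
        rintro rfl
        exact h13 ⟨ha, hb⟩
      omega
    · have := h1 _ hb
      have := h4 _ ha _ hb (by omega)
      have : b + 1 ≠ n := by
        rintro rfl
        exact h2n ⟨ha, hb⟩
      omega
    · have := h1 _ hb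
      have := h4 _ ha _ hb (by omega)
      omega

theorem gg_sep {n r : ℕ} (hn : 4 ≤ n) {A : Finset ℕ} (h : A ∈ sepSets n 1 r)
    (hA : (1 ∈ A ∨ 2 ∈ A)) (h3n : ¬ (3 ∈ A ∧ n ∈ A)) : gg A ∈ sepSets (n - 2) 1 (r - 1) := by
  have hf := mem_gg h
  obtain ⟨h1, h2, h3, h4⟩ := mem_sep.1 h
  refine mem_sep.2 ⟨?_, ?_, by omega, ?_⟩
  · intro a ha
    obtain ⟨hx, ha⟩ := (hf a).1 ha
    have := h1 _ ha
    omega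
  · rw [gg, Finset.card_image_of_injOn]
    · rcases hA with hA | hA
      · rw [Finset.erase_eq_of_notMem, Finset.card_erase_of_mem hA, h2]
        intro hb
        have := h4 1 hA 2 (Finset.mem_of_mem_erase hb)
        omega
      · rw [Finset.erase_eq_of_notMem (a := 1), Finset.card_erase_of_mem hA, h2]
        intro hb
        have := h4 1 hb 2 hA
        omega
    · intro a ha b hb hab
      simp only [Finset.coe_erase, Set.mem_sdiff, Finset.mem_coe, Set.mem_singleton_iff] at ha hb
      have := h1 a ha.1.1
      have := h1 b hb.1.1
      dsimp only at hab
      omega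
  · intro a ha b hb hab
    obtain ⟨hx, ha⟩ := (hf a).1 ha
    obtain ⟨hy, hb⟩ := (hf b).1 hb
    have := h1 _ ha
    have := h1 _ hb
    have := h4 _ ha _ hb (by omega)
    have : ¬ (a = 1 ∧ b + 2 = n) := by
      rintro ⟨rfl, rfl⟩
      exact h3n ⟨ha, hb⟩
    omega

theorem choose_step {n r : ℕ} (hr : 2 ≤ r) (hn : 2 * r ≤ n) :
    (n - r - 1).choose (r - 1) =
      (n - 1 - r - 1).choose (r - 1) + (n - 2 - (r - 1) - 1).choose (r - 1 - 1) := by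
  obtain ⟨s, rfl⟩ := Nat.exists_eq_add_of_le hr
  obtain ⟨m, rfl⟩ := Nat.exists_eq_add_of_le hn
  have e1 : 2 * (2 + s) + m - (2 + s) - 1 = (s + m) + 1 := by omega
  have e2 : 2 * (2 + s) + m - 1 - (2 + s) - 1 = s + m := by omega
  have e3 : 2 * (2 + s) + m - 2 - (2 + s - 1) - 1 = s + m := by omega
  have e4 : 2 + s - 1 = s + 1 := by omega
  rw [e1, e2, e3, e4, Nat.choose_succ_succ, add_comm]
  simp

theorem prop1 {a1 a2 b1 b2 : Prop} (h : a1 ∨ a2 ↔ b1 ∨ b2) (k1 : ¬ (a1 ∧ b2))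
    (k2 : ¬ (b1 ∧ a2)) (ha : ¬ (a1 ∧ a2)) (hb : ¬ (b1 ∧ b2)) : (a1 ↔ b1) ∧ (a2 ↔ b2) := by
  tauto

theorem prop2 {a1 a2 b1 b2 an bn : Prop} (h : an ↔ bn) (pA : a1 ∨ a2 ∧ an) (pB : b1 ∨ b2 ∧ bn)
    (k1 : ¬ (a1 ∧ an)) (k2 : ¬ (b1 ∧ bn)) (ha : ¬ (a1 ∧ a2)) (hb : ¬ (b1 ∧ b2)) :
    (a1 ↔ b1) ∧ (a2 ↔ b2) := by
  tauto

theorem upper (n : ℕ) : ∀ (r : ℕ), 1 ≤ r → ∀ (𝒜 : Finset (Finset ℕ)), 𝒜 ⊆ sepSets n 1 r →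
    Intersecting 𝒜 → 𝒜.card ≤ (n - r - 1).choose (r - 1) := by
  induction n using Nat.strong_induction_on with
  | _ n ih =>
  intro r hr 𝒜 h𝒜 hint
  by_cases hn : 2 * r ≤ n
  swap
  · have : 𝒜 = ∅ := by
      rw [Finset.eq_empty_iff_forall_notMem]
      intro A hA
      exact hn (sep_le (h𝒜 hA))
    simp [this]
  by_cases hr2 : r = 1
  · subst hr2
    simp only [Nat.sub_self, Nat.choose_zero_right]
    rw [Finset.card_le_one]
    intro A hA B hB
    obtain ⟨a, rfl⟩ := Finset.card_eq_one.1 (mem_sep.1 (h𝒜 hA)).2.1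
    obtain ⟨b, rfl⟩ := Finset.card_eq_one.1 (mem_sep.1 (h𝒜 hB)).2.1
    obtain ⟨x, hx⟩ := hint _ hA _ hB
    simp only [Finset.mem_inter, Finset.mem_singleton] at hx
    rw [← hx.1, ← hx.2]
  have hr2 : 2 ≤ r := by omega
  have hn4 : 4 ≤ n := by omega
  rw [choose_step hr2 hn]
  let P : Finset ℕ → Prop := fun A => (1 ∈ A ∧ insert 2 (A.erase 1) ∈ 𝒜) ∨
    (1 ∈ A ∧ 3 ∈ A) ∨ (2 ∈ A ∧ n ∈ A)
  classical
  rw [← Finset.card_filter_add_card_filter_not (s := 𝒜) P, add_comm]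
  have no12 : ∀ A ∈ 𝒜, ¬ (1 ∈ A ∧ 2 ∈ A) := by
    rintro A hA ⟨h1, h2⟩
    have := (mem_sep.1 (h𝒜 hA)).2.2.2 1 h1 2 h2
    omega
  have no1n : ∀ A ∈ 𝒜, ¬ (1 ∈ A ∧ n ∈ A) := by
    rintro A hA ⟨h1, h2⟩
    have := (mem_sep.1 (h𝒜 hA)).2.2.2 1 h1 n h2
    omega
  have no23 : ∀ A ∈ 𝒜, ¬ (2 ∈ A ∧ 3 ∈ A) := by
    rintro A hA ⟨h1, h2⟩
    have := (mem_sep.1 (h𝒜 hA)).2.2.2 2 h1 3 h2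
    omega
  have pos : ∀ A ∈ 𝒜, 0 ∉ A := by
    intro A hA h0
    have := (mem_sep.1 (h𝒜 hA)).1 0 h0
    omega
  apply add_le_add
  · -- the contracted part
    have hinj : Set.InjOn ff ((𝒜.filter fun A => ¬ P A : Finset (Finset ℕ)) : Set (Finset ℕ)) := by
      have key : ∀ A ∈ 𝒜, ∀ B ∈ 𝒜, ff A = ff B → 1 ∈ A → 2 ∈ B → P A := by
        intro A hA B hB hAB h1 h2
        left
        refine ⟨h1, ?_⟩
        convert hB using 1
        ext x
        have hx := congrArg (x - 1 ∈ ·) hAB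
        simp only [mem_ff (h𝒜 hA), mem_ff (h𝒜 hB), eq_iff_iff] at hx
        have a12 := no12 A hA
        have b12 := no12 B hB
        have a0 := pos A hA
        have b0 := pos B hB
        rcases (by omega : x = 0 ∨ x = 1 ∨ x = 2 ∨ 3 ≤ x) with rfl | rfl | rfl | h3
        · simp [a0, b0]
        · simpa using fun h => b12 ⟨h, h2⟩
        · simp [h2]
        · have e : x - 1 + 1 = x := by omega
          rw [e] at hx
          have e1 : x - 1 ≠ 1 := by omega
          have e2 : 2 ≤ x - 1 := by omega
          have e3 : x ≠ 2 := by omega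
          have e4 : x ≠ 1 := by omega
          simp [e1, e2] at hx
          simp [e3, e4, hx]
      intro A hA B hB hAB
      simp only [Finset.coe_filter, Set.mem_ofPred_eq] at hA hB
      obtain ⟨hA, pA⟩ := hA
      obtain ⟨hB, pB⟩ := hB
      have k1 : ¬ (1 ∈ A ∧ 2 ∈ B) := fun h => pA (key A hA B hB hAB h.1 h.2)
      have k2 : ¬ (1 ∈ B ∧ 2 ∈ A) := fun h => pB (key B hB A hA hAB.symm h.1 h.2)
      have h11 := congrArg (1 ∈ ·) hAB
      simp only [mem_ff (h𝒜 hA), mem_ff (h𝒜 hB), eq_iff_iff] at h11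
      have a12 := no12 A hA
      have b12 := no12 B hB
      have a0 := pos A hA
      have b0 := pos B hB
      simp at h11
      ext x
      have hx := congrArg (x - 1 ∈ ·) hAB
      simp only [mem_ff (h𝒜 hA), mem_ff (h𝒜 hB), eq_iff_iff] at hx
      rcases (by omega : x = 0 ∨ x = 1 ∨ x = 2 ∨ 3 ≤ x) with rfl | rfl | rfl | h3
      · simp [a0, b0]
      · exact (prop1 h11 k1 k2 a12 b12).1
      · exact (prop1 h11 k1 k2 a12 b12).2
      · have e : x - 1 + 1 = x := by omega
        rw [e] at hx
        have e1 : x - 1 ≠ 1 := by omega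
        have e2 : 2 ≤ x - 1 := by omega
        simpa [e1, e2] using hx
    rw [← Finset.card_image_of_injOn hinj]
    apply ih (n - 1) (by omega) r hr
    · intro X hX
      obtain ⟨A, hA, rfl⟩ := Finset.mem_image.1 hX
      obtain ⟨hA, pA⟩ := Finset.mem_filter.1 hA
      exact ff_sep hn4 (h𝒜 hA) (fun h => pA (Or.inr (Or.inl h))) (fun h => pA (Or.inr (Or.inr h)))
    · intro X hX Y hY
      obtain ⟨A, hA, rfl⟩ := Finset.mem_image.1 hX
      obtain ⟨B, hB, rfl⟩ := Finset.mem_image.1 hY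
      obtain ⟨x, hx⟩ := hint A (Finset.mem_filter.1 hA).1 B (Finset.mem_filter.1 hB).1
      rw [Finset.mem_inter] at hx
      exact ⟨max 1 (x - 1), Finset.mem_inter.2
        ⟨Finset.mem_image_of_mem _ hx.1, Finset.mem_image_of_mem _ hx.2⟩⟩
  · -- the removed part
    have hP12 : ∀ A, P A → 1 ∈ A ∨ (2 ∈ A ∧ n ∈ A) := by
      intro A h
      rcases h with h | h | h
      · exact Or.inl h.1
      · exact Or.inl h.1
      · exact Or.inr h
    have hinj : Set.InjOn gg ((𝒜.filter fun A => P A : Finset (Finset ℕ)) : Set (Finset ℕ)) := by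
      intro A hA B hB hAB
      simp only [Finset.coe_filter, Set.mem_ofPred_eq] at hA hB
      obtain ⟨hA, pA⟩ := hA
      obtain ⟨hB, pB⟩ := hB
      have hx : ∀ x, 3 ≤ x → (x ∈ A ↔ x ∈ B) := by
        intro x h3
        have hx := congrArg (x - 2 ∈ ·) hAB
        simp only [mem_gg (h𝒜 hA), mem_gg (h𝒜 hB), eq_iff_iff] at hx
        have e : x - 2 + 2 = x := by omega
        rw [e] at hx
        have e2 : 1 ≤ x - 2 := by omega
        simpa [e2] using hx
      have a12 := no12 A hA
      have b12 := no12 B hB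
      have a1n := no1n A hA
      have b1n := no1n B hB
      have hnn := hx n (by omega)
      have pA := hP12 A pA
      have pB := hP12 B pB
      ext x
      rcases (by omega : x = 0 ∨ x = 1 ∨ x = 2 ∨ 3 ≤ x) with rfl | rfl | rfl | h3
      · simp [pos A hA, pos B hB]
      · exact (prop2 hnn pA pB a1n b1n a12 b12).1
      · exact (prop2 hnn pA pB a1n b1n a12 b12).2
      · exact hx x h3
    rw [← Finset.card_image_of_injOn hinj]
    apply ih (n - 2) (by omega) (r - 1) (by omega)
    · intro X hX
      obtain ⟨A, hA, rfl⟩ := Finset.mem_image.1 hX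
      obtain ⟨hA, pA⟩ := Finset.mem_filter.1 hA
      have a1n := no1n A hA
      have a23 := no23 A hA
      have pA := hP12 A pA
      exact gg_sep hn4 (h𝒜 hA) (pA.imp id And.left)
        (fun h => pA.elim (fun h1 => a1n ⟨h1, h.2⟩) (fun h2 => a23 ⟨h2.1, h.1⟩))
    · intro X hX Y hY
      obtain ⟨A, hA, rfl⟩ := Finset.mem_image.1 hX
      obtain ⟨B, hB, rfl⟩ := Finset.mem_image.1 hY
      obtain ⟨hA, pA⟩ := Finset.mem_filter.1 hA
      obtain ⟨hB, pB⟩ := Finset.mem_filter.1 hB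
      suffices h : ∃ x, 3 ≤ x ∧ x ∈ A ∧ x ∈ B by
        obtain ⟨x, h3, h1, h2⟩ := h
        refine ⟨x - 2, ?_⟩
        have e : x - 2 + 2 = x := by omega
        rw [Finset.mem_inter, mem_gg (h𝒜 hA), mem_gg (h𝒜 hB), e]
        exact ⟨⟨by omega, h1⟩, by omega, h2⟩
      have a12 := no12 A hA
      have b12 := no12 B hB
      have big : ∀ x, x ∈ A → x ≠ 1 → x ≠ 2 → 3 ≤ x := by
        intro x hx h1 h2
        have : x ≠ 0 := fun h => pos A hA (h ▸ hx)
        omega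
      have meet : (¬ (1 ∈ A ∧ 1 ∈ B)) → (¬ (2 ∈ A ∧ 2 ∈ B)) → ∃ x, 3 ≤ x ∧ x ∈ A ∧ x ∈ B := by
        intro h1 h2
        obtain ⟨x, hx⟩ := hint A hA B hB
        rw [Finset.mem_inter] at hx
        exact ⟨x, big x hx.1 (by rintro rfl; exact h1 hx) (by rintro rfl; exact h2 hx), hx⟩
      by_cases c2 : 2 ∈ A ∧ 2 ∈ B
      · refine ⟨n, by omega, ?_⟩
        exact ⟨(hP12 A pA).elim (fun h => (a12 ⟨h, c2.1⟩).elim) And.right,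
          (hP12 B pB).elim (fun h => (b12 ⟨h, c2.2⟩).elim) And.right⟩
      by_cases c1 : 1 ∈ A ∧ 1 ∈ B
      swap
      · exact meet c1 c2
      have dcase : ∀ A ∈ 𝒜, ∀ B ∈ 𝒜, 1 ∈ A → 1 ∈ B → insert 2 (A.erase 1) ∈ 𝒜 →
          ∃ x, 3 ≤ x ∧ x ∈ A ∧ x ∈ B := by
        intro A hA B hB h1 h2 hd
        obtain ⟨x, hx⟩ := hint _ hd B hB
        simp only [Finset.mem_inter, Finset.mem_insert, Finset.mem_erase] at hx
        have : x ≠ 2 := by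
          rintro rfl
          exact no12 B hB ⟨h2, hx.2⟩
        have h0 : x ≠ 0 := by
          rintro rfl
          exact pos B hB hx.2
        have hx1 : x ≠ 1 ∧ x ∈ A := by
          rcases hx.1 with h | h
          · exact absurd h this
          · exact h
        exact ⟨x, by omega, hx1.2, hx.2⟩
      rcases pA with ⟨_, d⟩ | ⟨_, e⟩ | ⟨f, _⟩
      · exact dcase A hA B hB c1.1 c1.2 d
      · rcases pB with ⟨_, d⟩ | ⟨_, e'⟩ | ⟨f, _⟩
        · obtain ⟨x, h3, h1, h2⟩ := dcase B hB A hA c1.2 c1.1 d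
          exact ⟨x, h3, h2, h1⟩
        · exact ⟨3, le_refl _, e, e'⟩
        · exact (b12 ⟨c1.2, f⟩).elim
      · exact (a12 ⟨c1.1, f⟩).elim

/-- the family of separated sets containing 1 -/
def starFam (n r : ℕ) : Finset (Finset ℕ) := (sepSets n 1 r).filter fun A => 1 ∈ A

theorem mem_starFam {n r : ℕ} {A : Finset ℕ} : A ∈ starFam n r ↔ A ∈ sepSets n 1 r ∧ 1 ∈ A := by
  simp [starFam]

theorem lower (n : ℕ) : ∀ (r : ℕ), 1 ≤ r → 2 ≤ n → (n - r - 1).choose (r - 1) ≤ (starFam n r).card := by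
  induction n using Nat.strong_induction_on with
  | _ n ih =>
  intro r hr hn2
  by_cases hr2 : r = 1
  · subst hr2
    simp only [Nat.sub_self, Nat.choose_zero_right]
    rw [Nat.one_le_iff_ne_zero, Finset.card_ne_zero]
    refine ⟨{1}, mem_starFam.2 ⟨mem_sep.2 ⟨?_, by simp, by omega, ?_⟩, by simp⟩⟩
    · simp; omega
    · simp
  by_cases hn : 2 * r ≤ n
  swap
  · rw [Nat.choose_eq_zero_of_lt (by omega)]
    exact Nat.zero_le _
  have hr2 : 2 ≤ r := by omega
  rw [choose_step hr2 hn]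
  refine (add_le_add (ih (n - 1) (by omega) r hr (by omega))
    (ih (n - 2) (by omega) (r - 1) (by omega) (by omega))).trans ?_
  rw [← Finset.card_filter_add_card_filter_not (s := starFam n r) (fun A => ¬ 3 ∈ A)]
  apply add_le_add
  · apply Finset.card_le_card_of_injOn (fun A => insert 1 ((A.erase 1).image (fun j => j + 1)))
    · intro A hA
      obtain ⟨hA, hA1⟩ := mem_starFam.1 hA
      obtain ⟨h1, h2, h3, h4⟩ := mem_sep.1 hA
      have hA2 : 2 ∉ A := fun h => by
        have := h4 1 hA1 2 h
        omega
      refine Finset.mem_filter.2 ⟨mem_starFam.2 ⟨mem_sep.2 ⟨?_, ?_, by omega, ?_⟩, by simp⟩, ?_⟩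
      · intro a ha
        simp only [Finset.mem_insert, Finset.mem_image, Finset.mem_erase] at ha
        rcases ha with rfl | ⟨a, ⟨_, ha⟩, rfl⟩
        · omega
        · have := h1 a ha
          omega
      · rw [Finset.card_insert_of_notMem, Finset.card_image_of_injective _ (add_left_injective 1),
          Finset.card_erase_of_mem hA1, h2]
        · omega
        · simp only [Finset.mem_image, Finset.mem_erase, not_exists, not_and]
          rintro a ⟨_, ha⟩
          have := h1 a ha
          omega
      · intro a ha b hb hab
        simp only [Finset.mem_insert, Finset.mem_image, Finset.mem_erase] at ha hb
        rcases ha with rfl | ⟨a, ⟨_, ha⟩, rfl⟩ <;> rcases hb with rfl | ⟨b, ⟨_, hb⟩, rfl⟩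
        · omega
        · have := h1 b hb
          have := h4 1 hA1 b hb
          omega
        · omega
        · have := h4 a ha b hb
          omega
      · simp only [Finset.mem_insert, Finset.mem_image, Finset.mem_erase]
        rintro (h | ⟨a, ⟨_, ha⟩, h⟩)
        · omega
        · obtain rfl : a = 2 := by omega
          exact hA2 ha
    · intro A hA B hB hAB
      obtain ⟨hA, hA1⟩ := mem_starFam.1 hA
      obtain ⟨hB, hB1⟩ := mem_starFam.1 hB
      have a0 : 0 ∉ A := fun h => by
        have := (mem_sep.1 hA).1 0 h
        omega
      have b0 : 0 ∉ B := fun h => by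
        have := (mem_sep.1 hB).1 0 h
        omega
      ext x
      have hx := congrArg (x + 1 ∈ ·) hAB
      by_cases x0 : x = 0
      · subst x0; simp [a0, b0]
      by_cases x1 : x = 1
      · subst x1; simp [hA1, hB1]
      · simpa [x0, x1] using hx
  · apply Finset.card_le_card_of_injOn (fun A => insert 1 (A.image (fun j => j + 2)))
    · intro A hA
      obtain ⟨hA, hA1⟩ := mem_starFam.1 hA
      obtain ⟨h1, h2, h3, h4⟩ := mem_sep.1 hA
      refine Finset.mem_filter.2 ⟨mem_starFam.2 ⟨mem_sep.2 ⟨?_, ?_, by omega, ?_⟩, by simp⟩, ?_⟩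
      · intro a ha
        simp only [Finset.mem_insert, Finset.mem_image] at ha
        rcases ha with rfl | ⟨a, ha, rfl⟩
        · omega
        · have := h1 a ha
          omega
      · rw [Finset.card_insert_of_notMem, Finset.card_image_of_injective _ (add_left_injective 2), h2]
        · omega
        · simp
      · intro a ha b hb hab
        simp only [Finset.mem_insert, Finset.mem_image] at ha hb
        rcases ha with rfl | ⟨a, ha, rfl⟩ <;> rcases hb with rfl | ⟨b, hb, rfl⟩
        · omega
        · have := h1 b hb
          have := h4 1 hA1 b hb
          omega
        · omega
        · have := h4 a ha b hb
          omega
      · simp [hA1]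
    · intro A hA B hB hAB
      ext x
      have hx := congrArg (x + 2 ∈ ·) hAB
      simpa using hx

theorem stmt0 (n r : ℕ) (hr : 1 ≤ r) (hn : 2 * r ≤ n)
    (𝒜 : Finset (Finset ℕ)) (h𝒜 : 𝒜 ⊆ sepSets n 1 r) (hint : Intersecting 𝒜) :
    𝒜.card ≤ (n - r - 1).choose (r - 1) ∧
      ((sepSets n 1 r).filter fun A => 1 ∈ A).card = (n - r - 1).choose (r - 1) := by
  refine ⟨upper n r hr 𝒜 h𝒜 hint, le_antisymm (upper n r hr _ (Finset.filter_subset _ _) ?_)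
    (lower n r hr (by omega))⟩
  intro A hA B hB
  exact ⟨1, Finset.mem_inter.2 ⟨(Finset.mem_filter.1 hA).2, (Finset.mem_filter.1 hB).2⟩⟩
end

section
/- Let r ≥ 2, let n = 2r+2, let d = ⌊r/2⌋, and for 1 ≤ i ≤ d define ℬ_i = {A ∈ [n]^(r)_* : |A ∩ {1, 3, 5, ..., 4i+1}| ≥ i+1}. Then each ℬ_i is an intersecting family and |ℬ_i| = binomial(n−r−1, r−1) = binomial(r+1, r−1). -/
/-- Block `j` (that is `{2j+1, 2j+2}`) contributes its odd element. -/
def odBlk (m q j : ℕ) : Prop := (q ≤ m ∧ (j < q ∨ m < j)) ∨ (m < q ∧ m < j ∧ j < q)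

instance (m q j : ℕ) : Decidable (odBlk m q j) := by unfold odBlk; infer_instance

/-- element of block `j` -/
def elBlk (m q j : ℕ) : ℕ := 2 * j + 1 + (if odBlk m q j then 0 else 1)

/-- the separated set with blank block `m` and switch `q` -/
def setBlk (r m q : ℕ) : Finset ℕ := ((Finset.range (r + 1)).erase m).image (elBlk m q)

lemma odd_mem_setBlk (r m q j : ℕ) : 2 * j + 1 ∈ setBlk r m q ↔ j ≤ r ∧ odBlk m q j := by
  simp only [setBlk, Finset.mem_image, Finset.mem_erase, Finset.mem_range, elBlk]
  constructor
  · rintro ⟨k, ⟨h1, h2⟩, h3⟩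
    split_ifs at h3 with h
    · have : k = j := by omega
      subst this
      exact ⟨by omega, h⟩
    · omega
  · rintro ⟨h1, h2⟩
    refine ⟨j, ⟨?_, by omega⟩, by simp [h2]⟩
    unfold odBlk at h2
    omega

lemma even_mem_setBlk (r m q j : ℕ) :
    2 * j + 2 ∈ setBlk r m q ↔ j ≤ r ∧ j ≠ m ∧ ¬ odBlk m q j := by
  simp only [setBlk, Finset.mem_image, Finset.mem_erase, Finset.mem_range, elBlk]
  constructor
  · rintro ⟨k, ⟨h1, h2⟩, h3⟩
    split_ifs at h3 with h
    · omega
    · have : k = j := by omega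
      subst this
      exact ⟨by omega, h1, h⟩
  · rintro ⟨h1, h2, h3⟩
    exact ⟨j, ⟨h2, by omega⟩, by simp [h3]⟩

lemma setBlk_mem (r m q : ℕ) (hr : 2 ≤ r) (hm : m ≤ r) (hq : q ≤ r) :
    setBlk r m q ∈ sepSets (2 * r + 2) 1 r := by
  simp only [sepSets, Finset.mem_filter, Finset.mem_powerset]
  refine ⟨?_, ?_, by omega, ?_⟩
  · intro a ha
    simp only [setBlk, Finset.mem_image, Finset.mem_erase, Finset.mem_range, elBlk] at ha
    obtain ⟨k, ⟨h1, h2⟩, h3⟩ := ha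
    simp only [Finset.mem_Icc]
    split_ifs at h3 <;> omega
  · unfold setBlk
    rw [Finset.card_image_of_injective, Finset.card_erase_of_mem (by simp; omega)]
    · simp
    · intro a b h
      simp only [elBlk] at h
      split_ifs at h <;> omega
  · intro a ha b hb hab
    simp only [setBlk, Finset.mem_image, Finset.mem_erase, Finset.mem_range, elBlk] at ha hb
    obtain ⟨k, ⟨h1, h2⟩, h3⟩ := ha
    obtain ⟨l, ⟨h4, h5⟩, h6⟩ := hb
    by_cases hk : odBlk m q k <;> by_cases hl : odBlk m q l <;>
      simp only [hk, hl, if_true, if_false] at h3 h6 <;> unfold odBlk at hk hl <;> omega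

lemma setBlk_inj (r m q m' q' : ℕ) (hm : m ≤ r) (hq : q ≤ r) (hm' : m' ≤ r) (hq' : q' ≤ r)
    (h : setBlk r m q = setBlk r m' q') : m = m' ∧ q = q' := by
  have ho : ∀ j, (j ≤ r ∧ odBlk m q j) ↔ (j ≤ r ∧ odBlk m' q' j) := fun j => by
    rw [← odd_mem_setBlk, ← odd_mem_setBlk, h]
  have he : ∀ j, (j ≤ r ∧ j ≠ m ∧ ¬ odBlk m q j) ↔ (j ≤ r ∧ j ≠ m' ∧ ¬ odBlk m' q' j) :=
    fun j => by rw [← even_mem_setBlk, ← even_mem_setBlk, h]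
  have hmm : m = m' := by
    by_contra hne
    have h1 := ho m
    have h2 := he m
    have h3 : ¬ odBlk m q m := by unfold odBlk; omega
    tauto
  subst hmm
  refine ⟨rfl, ?_⟩
  have h1 := ho q
  have h2 := ho q'
  unfold odBlk at h1 h2
  omega

lemma setBlk_surj (r : ℕ) (hr : 2 ≤ r) (A : Finset ℕ) (hA : A ∈ sepSets (2 * r + 2) 1 r) :
    ∃ m q, m ≤ r ∧ q ≤ r ∧ setBlk r m q = A := by
  simp only [sepSets, Finset.mem_filter, Finset.mem_powerset] at hA
  obtain ⟨hsub, hcard, -, hsep⟩ := hA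
  have hb : ∀ a ∈ A, 1 ≤ a ∧ a ≤ 2 * r + 2 := fun a ha => Finset.mem_Icc.1 (hsub ha)
  have hinj : Set.InjOn (fun a => (a - 1) / 2) (A : Set ℕ) := by
    intro a ha b hb' hab
    have h1 := hb a ha
    have h2 := hb b hb'
    simp only at hab
    rcases lt_trichotomy a b with h | h | h
    · have := hsep a ha b hb' h; omega
    · exact h
    · have := hsep b hb' a ha h; omega
  have hic : (A.image (fun a => (a - 1) / 2)).card = r := by
    rw [Finset.card_image_of_injOn hinj, hcard]
  have his : A.image (fun a => (a - 1) / 2) ⊆ Finset.range (r + 1) := by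
    intro x hx
    obtain ⟨a, ha, rfl⟩ := Finset.mem_image.1 hx
    have := hb a ha
    simp only [Finset.mem_range]
    omega
  have hc1 : (Finset.range (r + 1) \ A.image (fun a => (a - 1) / 2)).card = 1 := by
    rw [Finset.card_sdiff_of_subset his, hic]; simp
  obtain ⟨m, hm⟩ := Finset.card_eq_one.1 hc1
  have hmem : ∀ j, (j ≤ r ∧ 2 * j + 1 ∉ A ∧ 2 * j + 2 ∉ A) ↔ j = m := by
    intro j
    rw [← Finset.mem_singleton, ← hm, Finset.mem_sdiff, Finset.mem_range, Finset.mem_image]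
    constructor
    · rintro ⟨h1, h2, h3⟩
      refine ⟨by omega, ?_⟩
      rintro ⟨a, ha, h⟩
      have := hb a ha
      have : a = 2 * j + 1 ∨ a = 2 * j + 2 := by omega
      rcases this with rfl | rfl <;> contradiction
    · rintro ⟨h1, h2⟩
      refine ⟨by omega, fun h => h2 ⟨_, h, by omega⟩, fun h => h2 ⟨_, h, by omega⟩⟩
  obtain ⟨hmr, hm1, hm2⟩ := (hmem m).2 rfl
  have hblk : ∀ j, j ≤ r → j ≠ m → (2 * j + 1 ∈ A ∨ 2 * j + 2 ∈ A) := by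
    intro j h1 h2
    by_contra h
    push Not at h
    exact h2 ((hmem j).1 ⟨h1, h⟩)
  have hnb : ∀ j, 2 * j + 1 ∈ A → 2 * j + 2 ∉ A := by
    intro j h1 h2
    have := hsep _ h1 _ h2 (by omega)
    omega
  have hstep : ∀ j, 2 * j + 1 ∉ A → j + 1 ≤ r → j ≠ m → 2 * (j + 1) + 1 ∉ A := by
    intro j h1 h2 h3 h4
    have h5 := (hblk j (by omega) h3).resolve_left h1
    have := hsep _ h5 _ h4 (by omega)
    omega
  have hmono : ∀ j k, j ≤ k → 2 * j + 1 ∉ A → k ≤ r → (k ≤ m ∨ m < j) → 2 * k + 1 ∉ A := by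
    intro j k hjk
    induction k, hjk using Nat.le_induction with
    | base => intro h _ _; exact h
    | succ k hk ih =>
      intro h1 h2 h3
      exact hstep k (ih h1 (by omega) (by omega)) h2 (by omega)
  -- it suffices to identify the odd blocks
  have key : ∀ q, (∀ j, j ≤ r → (2 * j + 1 ∈ A ↔ odBlk m q j)) → setBlk r m q = A := by
    intro q hq
    ext a
    rcases Nat.eq_zero_or_pos a with rfl | ha
    · constructor
      · intro h
        simp only [setBlk, Finset.mem_image, elBlk] at h
        obtain ⟨k, _, h⟩ := h
        omega
      · intro h; have := hb 0 h; omega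
    have : a = 2 * ((a - 1) / 2) + 1 ∨ a = 2 * ((a - 1) / 2) + 2 := by omega
    generalize (a - 1) / 2 = j at this
    rcases this with rfl | rfl
    · rw [odd_mem_setBlk]
      constructor
      · rintro ⟨h1, h2⟩; exact (hq j h1).2 h2
      · intro h
        have := hb _ h
        exact ⟨by omega, (hq j (by omega)).1 h⟩
    · rw [even_mem_setBlk]
      constructor
      · rintro ⟨h1, h2, h3⟩
        exact (hblk j h1 h2).resolve_left fun h => h3 ((hq j h1).1 h)
      · intro h
        have := hb _ h
        refine ⟨by omega, ?_, fun h' => hnb j ((hq j (by omega)).2 h') h⟩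
        rintro rfl
        exact hm2 h
  by_cases hex : ∃ j, m < j ∧ j ≤ r ∧ 2 * j + 1 ∉ A
  · obtain ⟨h1, h2, h3⟩ := Nat.find_spec hex
    have hmin : ∀ j, j < Nat.find hex → ¬ (m < j ∧ j ≤ r ∧ 2 * j + 1 ∉ A) :=
      fun j hj => Nat.find_min hex hj
    generalize Nat.find hex = q at *
    refine ⟨m, q, hmr, h2, key q ?_⟩
    have hr0 : 2 * r + 2 ∈ A :=
      (hblk r le_rfl (by omega)).resolve_left (hmono q r h2 h3 le_rfl (Or.inr h1))
    have h0 : 2 * 0 + 1 ∉ A := by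
      intro h
      have := hsep _ h _ hr0 (by omega)
      omega
    intro j hj
    unfold odBlk
    constructor
    · intro h
      right
      refine ⟨h1, ?_, ?_⟩
      · by_contra hc
        exact hmono 0 j (by omega) h0 hj (by omega) h
      · by_contra hc
        exact hmono q j (by omega) h3 hj (by omega) h
    · intro h
      have h4 : m < j ∧ j < q := by omega
      by_contra hc
      exact hmin j h4.2 ⟨h4.1, hj, hc⟩
  · push Not at hex
    have hex2 : ∃ j, 2 * j + 1 ∉ A := ⟨m, hm1⟩
    have h3 := Nat.find_spec hex2
    have hmin : ∀ j, j < Nat.find hex2 → ¬ (2 * j + 1 ∉ A) :=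
      fun j hj => Nat.find_min hex2 hj
    have hle : Nat.find hex2 ≤ m := Nat.find_min' hex2 hm1
    generalize Nat.find hex2 = q at *
    refine ⟨m, q, hmr, by omega, key q ?_⟩
    intro j hj
    unfold odBlk
    constructor
    · intro h
      left
      refine ⟨hle, ?_⟩
      by_contra hc
      exact hmono q j (by omega) h3 hj (by omega) h
    · intro h
      have h4 : j < q ∨ m < j := by omega
      rcases h4 with h4 | h4
      · exact not_not.1 (hmin j h4)
      · exact hex j h4 hj

lemma card_inter_odd (A : Finset ℕ) (N : ℕ) :
    (A ∩ (Finset.range N).image fun j => 2 * j + 1).card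
      = ((Finset.range N).filter fun j => 2 * j + 1 ∈ A).card := by
  rw [← Finset.card_image_of_injective (f := fun j : ℕ => 2 * j + 1)
    ((Finset.range N).filter fun j => 2 * j + 1 ∈ A) (fun a b h => by simp only at h; omega)]
  congr 1
  ext a
  simp only [Finset.mem_inter, Finset.mem_image, Finset.mem_filter]
  constructor
  · rintro ⟨h, j, hj, rfl⟩; exact ⟨j, ⟨hj, h⟩, rfl⟩
  · rintro ⟨j, ⟨hj, h⟩, rfl⟩; exact ⟨h, j, hj, rfl⟩

/-- cyclic successor -/
def cSucc (r m : ℕ) : ℕ := if m = r then 0 else m + 1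
/-- cyclic predecessor -/
def cPred (r m : ℕ) : ℕ := if m = 0 then r else m - 1

lemma cPred_cSucc (r a : ℕ) (h : a ≤ r) : cPred r (cSucc r a) = a := by
  unfold cSucc
  split_ifs with h1
  · simp [cPred, h1]
  · simp [cPred]

lemma cSucc_cPred (r a : ℕ) (h : a ≤ r) : cSucc r (cPred r a) = a := by
  unfold cPred
  split_ifs with h1
  · simp [cSucc, h1]
  · unfold cSucc
    rw [if_neg (by omega)]
    omega

lemma count_pairs (r i : ℕ) (hi : 2 * i ≤ r) :
    2 * (((Finset.range (r + 1)) ×ˢ (Finset.range (r + 1))).filter fun p =>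
      i + 1 ≤ ((Finset.range (2 * i + 1)).filter fun j => odBlk p.1 p.2 j).card).card
      = (r + 1) * r := by
  set U := (Finset.range (r + 1)) ×ˢ (Finset.range (r + 1)) with hU
  set c : ℕ × ℕ → ℕ := fun p => ((Finset.range (2 * i + 1)).filter fun j => odBlk p.1 p.2 j).card
    with hc
  set V := U.filter fun p => p.2 ≠ cSucc r p.1 with hV
  have hVcard : V.card = (r + 1) * r := by
    have h1 : (U.filter fun p => p.2 = cSucc r p.1).card = r + 1 := by
      have : (U.filter fun p => p.2 = cSucc r p.1)
          = (Finset.range (r + 1)).image fun m => (m, cSucc r m) := by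
        ext ⟨a, b⟩
        simp only [hU, Finset.mem_filter, Finset.mem_product, Finset.mem_range, Finset.mem_image,
          Prod.mk.injEq, cSucc]
        constructor
        · rintro ⟨⟨h1, h2⟩, h3⟩; exact ⟨a, h1, rfl, h3.symm⟩
        · rintro ⟨m, h1, rfl, h2⟩
          refine ⟨⟨h1, ?_⟩, h2.symm⟩
          split_ifs at h2 <;> omega
      rw [this, Finset.card_image_of_injective, Finset.card_range]
      intro a b h
      exact (Prod.mk.inj h).1
    have h2 := Finset.card_filter_add_card_filter_not (s := U) (fun p => p.2 = cSucc r p.1)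
    have h3 : U.card = (r + 1) * (r + 1) := by simp [hU]
    have h4 : V.card = (U.filter fun p => ¬ p.2 = cSucc r p.1).card := rfl
    rw [h1, h3, ← h4] at h2
    nlinarith
  have hS : (U.filter fun p => i + 1 ≤ c p) = V.filter fun p => i + 1 ≤ c p := by
    ext ⟨a, b⟩
    simp only [hV, Finset.mem_filter]
    constructor
    · rintro ⟨h1, h2⟩
      refine ⟨⟨h1, ?_⟩, h2⟩
      intro h
      have : c (a, b) = 0 := by
        simp only [hc, Finset.card_eq_zero, Finset.filter_eq_empty_iff, Finset.mem_range]
        intro j hj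
        simp only [hU, Finset.mem_product, Finset.mem_range] at h1
        unfold cSucc at h
        unfold odBlk
        split_ifs at h <;> omega
      omega
    · rintro ⟨⟨h1, _⟩, h2⟩; exact ⟨h1, h2⟩
  change 2 * (U.filter fun p => i + 1 ≤ c p).card = _
  rw [hS, ← hVcard, ← Finset.card_filter_add_card_filter_not (s := V) (fun p => i + 1 ≤ c p),
    two_mul]
  congr 1
  have hphiV : ∀ p ∈ V, (cPred r p.2, cSucc r p.1) ∈ V := by
    rintro ⟨a, b⟩ h
    simp only [hV, hU, Finset.mem_filter, Finset.mem_product, Finset.mem_range, cSucc, cPred]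
      at h ⊢
    split_ifs at h ⊢ <;> omega
  have hphi2 : ∀ p ∈ V, (cPred r (cSucc r p.1), cSucc r (cPred r p.2)) = p := by
    rintro ⟨a, b⟩ h
    simp only [hV, hU, Finset.mem_filter, Finset.mem_product, Finset.mem_range,
      Prod.mk.injEq] at h ⊢
    exact ⟨cPred_cSucc r a (by omega), cSucc_cPred r b (by omega)⟩
  have hphic : ∀ p ∈ V, c p + c (cPred r p.2, cSucc r p.1) = 2 * i + 1 := by
    rintro ⟨a, b⟩ h
    have h2 := Finset.card_filter_add_card_filter_not (s := Finset.range (2 * i + 1))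
      (fun j => odBlk a b j)
    rw [Finset.card_range] at h2
    rw [← h2]
    simp only [hc]
    congr 2
    apply Finset.filter_congr
    intro j hj
    simp only [hV, hU, Finset.mem_filter, Finset.mem_product, Finset.mem_range] at h hj
    unfold cSucc at h
    unfold odBlk cSucc cPred
    split_ifs at h ⊢ <;> omega
  refine Finset.card_bij' (fun p _ => (cPred r p.2, cSucc r p.1))
    (fun p _ => (cPred r p.2, cSucc r p.1)) ?_ ?_ ?_ ?_
  · intro p hp
    rw [Finset.mem_filter] at hp ⊢
    have := hphic p hp.1
    exact ⟨hphiV p hp.1, by omega⟩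
  · intro p hp
    rw [Finset.mem_filter] at hp ⊢
    have := hphic p hp.1
    exact ⟨hphiV p hp.1, by omega⟩
  · intro p hp
    exact hphi2 p (Finset.mem_filter.1 hp).1
  · intro p hp
    exact hphi2 p (Finset.mem_filter.1 hp).1

theorem stmt2 (r n d : ℕ) (hr : 2 ≤ r) (hn : n = 2 * r + 2) (hd : d = r / 2)
    (i : ℕ) (hi1 : 1 ≤ i) (hi2 : i ≤ d) :
    Intersecting ((sepSets n 1 r).filter fun A =>
        i + 1 ≤ (A ∩ (Finset.range (2 * i + 1)).image fun j => 2 * j + 1).card) ∧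
      ((sepSets n 1 r).filter fun A =>
          i + 1 ≤ (A ∩ (Finset.range (2 * i + 1)).image fun j => 2 * j + 1).card).card
        = (n - r - 1).choose (r - 1) ∧
      (n - r - 1).choose (r - 1) = (r + 1).choose (r - 1) := by
  have hnr : n - r - 1 = r + 1 := by omega
  have hir : 2 * i ≤ r := by omega
  refine ⟨?_, ?_, by rw [hnr]⟩
  · intro A hA B hB
    rw [Finset.mem_filter] at hA hB
    obtain ⟨-, hA⟩ := hA
    obtain ⟨-, hB⟩ := hB
    rw [card_inter_odd] at hA hB
    by_contra hne
    rw [Finset.not_nonempty_iff_eq_empty] at hne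
    have hdis : Disjoint ((Finset.range (2 * i + 1)).filter fun j => 2 * j + 1 ∈ A)
        ((Finset.range (2 * i + 1)).filter fun j => 2 * j + 1 ∈ B) := by
      rw [Finset.disjoint_left]
      intro j h1 h2
      have : 2 * j + 1 ∈ A ∩ B :=
        Finset.mem_inter.2 ⟨(Finset.mem_filter.1 h1).2, (Finset.mem_filter.1 h2).2⟩
      rw [hne] at this
      simp at this
    have h1 := Finset.card_union_of_disjoint hdis
    have h2 := Finset.card_le_card (Finset.union_subset
      (Finset.filter_subset (fun j => 2 * j + 1 ∈ A) (Finset.range (2 * i + 1)))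
      (Finset.filter_subset (fun j => 2 * j + 1 ∈ B) (Finset.range (2 * i + 1))))
    rw [Finset.card_range] at h2
    omega
  · subst hn
    have hcnt := count_pairs r i hir
    have hcc : ∀ m q, ((setBlk r m q) ∩ (Finset.range (2 * i + 1)).image fun j => 2 * j + 1).card
        = ((Finset.range (2 * i + 1)).filter fun j => odBlk m q j).card := by
      intro m q
      rw [card_inter_odd]
      congr 1
      apply Finset.filter_congr
      intro j hj
      rw [Finset.mem_range] at hj
      rw [odd_mem_setBlk]
      exact ⟨fun h => h.2, fun h => ⟨by omega, h⟩⟩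
    have hbij : (((Finset.range (r + 1)) ×ˢ (Finset.range (r + 1))).filter fun p =>
      i + 1 ≤ ((Finset.range (2 * i + 1)).filter fun j => odBlk p.1 p.2 j).card).card =
      ((sepSets (2 * r + 2) 1 r).filter fun A =>
          i + 1 ≤ (A ∩ (Finset.range (2 * i + 1)).image fun j => 2 * j + 1).card).card := by
      refine Finset.card_bij (fun p _ => setBlk r p.1 p.2) ?_ ?_ ?_
      · rintro ⟨m, q⟩ h
        simp only [Finset.mem_filter, Finset.mem_product, Finset.mem_range] at h
        rw [Finset.mem_filter, hcc]
        exact ⟨setBlk_mem r m q hr (by omega) (by omega), h.2⟩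
      · rintro ⟨m, q⟩ h ⟨m', q'⟩ h' heq
        simp only [Finset.mem_filter, Finset.mem_product, Finset.mem_range] at h h'
        obtain ⟨h1, h2⟩ := setBlk_inj r m q m' q' (by omega) (by omega) (by omega) (by omega) heq
        rw [h1, h2]
      · intro A hA
        rw [Finset.mem_filter] at hA
        obtain ⟨m, q, hm, hq, rfl⟩ := setBlk_surj r hr A hA.1
        refine ⟨(m, q), ?_, rfl⟩
        rw [hcc] at hA
        simp only [Finset.mem_filter, Finset.mem_product, Finset.mem_range]
        exact ⟨⟨by omega, by omega⟩, hA.2⟩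
    rw [← hbij, hnr]
    have h1 : (r + 1).choose (r - 1) = (r + 1).choose 2 := by
      apply Nat.choose_symm_of_eq_add
      omega
    rw [h1, Nat.choose_two_right, Nat.add_sub_cancel]
    omega
end
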